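/- arXiv:2003.10148 — 6 statements merged into one kernel-verified Lean document; each statement's English description precedes it below -/
import Mathlib

section
/- Let R be a unital associative ring, M a left R-module, N ⊆ M an R-submodule, g ∈ R, and a ∈ R such that a • n = 0 for all n ∈ N. Let v ∈ M satisfy g • v ∈ N. Then for every natural number t one has g^t • (a • v) = (δ_g^t(a)) • v, where δ_g(b) = g*b − b*g and δ_g^t is the t-th iterate. -/
/-- The iterates of the inner derivation `b ↦ g * b - b * g` preserve the annihilator of a
submodule. -/
theorem iterate_commutator_smul_eq_zero {R M : Type*} [Ring R] [AddCommGroup M] [Module R M]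
    (N : Submodule R M) (g a : R) (hN : ∀ n ∈ N, a • n = 0) (t : ℕ) :
    ∀ n ∈ N, ((fun b => g * b - b * g)^[t] a) • n = 0 := by
  induction t with
  | zero => exact hN
  | succ t ih =>
    intro n hn
    rw [Function.iterate_succ_apply', sub_smul, mul_smul, mul_smul, ih n hn,
      ih _ (N.smul_mem g hn), smul_zero, sub_zero]

/-- Let `R` be a ring, `M` a left `R`-module, `N ⊆ M` a submodule,
`g a : R` with `a • n = 0` for all `n ∈ N`, and `v : M` with `g • v ∈ N`.  Then for
every `t : ℕ`, `g^t • (a • v) = (δ_g^[t] a) • v`, where `δ_g b = g*b - b*g`. -/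
theorem pow_smul_annihilator_smul {R M : Type*} [Ring R] [AddCommGroup M] [Module R M]
    (N : Submodule R M) (g a : R)
    (hN : ∀ n ∈ N, a • n = 0) (v : M) (hv : g • v ∈ N) (t : ℕ) :
    g ^ t • (a • v) = ((fun b => g * b - b * g)^[t] a) • v := by
  induction t with
  | zero => simp
  | succ t ih =>
    rw [pow_succ', mul_smul, ih, Function.iterate_succ_apply', sub_smul, mul_smul, mul_smul,
      iterate_commutator_smul_eq_zero N g a hN t _ hv, sub_zero]
end

section
/- Let R be a unital associative ring, M a left R-module, N ⊆ M an R-submodule, and g ∈ R such that: (i) the action of g on M is injective (g • v = 0 implies v = 0 for v ∈ M); (ii) for every v ∈ M there exists r ∈ ℕ with g^r • v ∈ N; (iii) δ_g is locally nilpotent on R, i.e. for every a ∈ R there exists t ∈ ℕ with δ_g^t(a) = 0, where δ_g(b) = g*b − b*g. Then for every a ∈ R: a • n = 0 for all n ∈ N if and only if a • v = 0 for all v ∈ M; that is, the annihilator of N in R equals the annihilator of M in R. -/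
/-- Let `R` be a ring, `M` a left `R`-module, `N ⊆ M` a submodule,
and `g : R` such that (i) `g` acts injectively on `M`, (ii) every `v ∈ M` is carried
into `N` by some power of `g`, (iii) the inner derivation `δ_g b = g*b - b*g` is
locally nilpotent on `R`.  Then for every `a : R`, `a` annihilates `N` iff `a`
annihilates `M`. -/
theorem annihilator_submodule_eq_annihilator {R M : Type*} [Ring R] [AddCommGroup M]
    [Module R M] (N : Submodule R M) (g : R)
    (hinj : ∀ v : M, g • v = 0 → v = 0)
    (hsat : ∀ v : M, ∃ r : ℕ, g ^ r • v ∈ N)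
    (hnil : ∀ a : R, ∃ t : ℕ, (fun b => g * b - b * g)^[t] a = 0)
    (a : R) :
    (∀ n ∈ N, a • n = 0) ↔ ∀ v : M, a • v = 0 := by
  refine ⟨fun ha => ?_, fun ha n _ => ha n⟩
  obtain ⟨t, ht⟩ := hnil a
  induction t generalizing a with
  | zero =>
    intro v
    have h : a = 0 := ht
    rw [h, zero_smul]
  | succ t ih =>
    have hcomm : ∀ v : M, g • a • v = a • g • v := by
      intro v
      have h := ih (g * a - a * g)
        (fun n hn => by
          rw [sub_smul, mul_smul, mul_smul, ha n hn, ha _ (N.smul_mem g hn), smul_zero, sub_zero])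
        ht v
      rwa [sub_smul, mul_smul, mul_smul, sub_eq_zero] at h
    have hpow : ∀ (r : ℕ) (v : M), g ^ r • v ∈ N → a • v = 0 := by
      intro r
      induction r with
      | zero => exact fun v hv => ha v (by simpa using hv)
      | succ r ihr =>
        intro v hv
        rw [pow_succ, mul_smul] at hv
        exact hinj _ ((hcomm v).trans (ihr _ hv))
    intro v
    obtain ⟨r, hr⟩ := hsat v
    exact hpow r v hr
end

section
/- Let R be a unital associative ring and let f_1, …, f_m ∈ R be pairwise commuting elements such that each δ_{f_i} is locally nilpotent on R (for every a ∈ R there exists n with δ_{f_i}^n(a) = 0). Then δ_{f_1 f_2 ⋯ f_m} is locally nilpotent on R: for every a ∈ R there exists n ∈ ℕ with δ_{f_1⋯f_m}^n(a) = 0. -/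
/-- If `A` and `B` commute and powers of each kill `a`, then so does a power of `A + B`. -/
theorem Module.End.add_pow_add_apply_eq_zero {S M : Type*} [Semiring S] [AddCommMonoid M]
    [Module S M] {A B : Module.End S M} (h : Commute A B) {a : M} {p q : ℕ}
    (hp : (A ^ p) a = 0) (hq : (B ^ q) a = 0) : ((A + B) ^ (p + q)) a = 0 := by
  rw [h.add_pow', LinearMap.sum_apply]
  refine Finset.sum_eq_zero fun ⟨i, j⟩ hij => ?_
  rw [Finset.HasAntidiagonal.mem_antidiagonal] at hij
  rw [LinearMap.smul_apply]
  obtain hi | hj : p ≤ i ∨ q ≤ j := by dsimp only at hij; omega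
  · rw [(h.pow_pow i j).eq, Module.End.mul_apply, Module.End.pow_map_zero_of_le hi hp, map_zero,
      smul_zero]
  · rw [Module.End.mul_apply, Module.End.pow_map_zero_of_le hj hq, map_zero, smul_zero]

/-- The inner derivation `b ↦ h * b - b * h` as an additive endomorphism. -/
def innerDerivEnd {R : Type*} [Ring R] (h : R) : Module.End ℤ R :=
  LinearMap.mulLeft ℤ h - LinearMap.mulRight ℤ h

theorem innerDerivEnd_apply {R : Type*} [Ring R] (h b : R) :
    innerDerivEnd h b = h * b - b * h := rfl

theorem innerDerivEnd_pow_apply {R : Type*} [Ring R] (h a : R) (n : ℕ) :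
    (innerDerivEnd h ^ n) a = (fun b => h * b - b * h)^[n] a :=
  Module.End.pow_apply _ _ _

theorem innerDerivEnd_mul {R : Type*} [Ring R] (x y : R) :
    innerDerivEnd (x * y) = LinearMap.mulLeft ℤ x * innerDerivEnd y +
      LinearMap.mulRight ℤ y * innerDerivEnd x := by
  ext b
  simp only [innerDerivEnd_apply, LinearMap.add_apply, Module.End.mul_apply,
    LinearMap.mulLeft_apply, LinearMap.mulRight_apply]
  noncomm_ring

theorem commute_mulLeft_innerDerivEnd {R : Type*} [Ring R] {x y : R} (h : Commute x y) :
    Commute (LinearMap.mulLeft ℤ x) (innerDerivEnd y) := by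
  refine Commute.sub_right ?_ (LinearMap.commute_mulLeft_right x y)
  ext b
  simp [← mul_assoc, h.eq]

theorem commute_mulRight_innerDerivEnd {R : Type*} [Ring R] {x y : R} (h : Commute x y) :
    Commute (LinearMap.mulRight ℤ x) (innerDerivEnd y) := by
  refine Commute.sub_right (LinearMap.commute_mulLeft_right y x).symm ?_
  ext b
  simp [mul_assoc, h.eq]

theorem commute_innerDerivEnd {R : Type*} [Ring R] {x y : R} (h : Commute x y) :
    Commute (innerDerivEnd x) (innerDerivEnd y) :=
  (commute_mulLeft_innerDerivEnd h).sub_left (commute_mulRight_innerDerivEnd h)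

theorem innerDerivEnd_mul_pow_apply_eq_zero {R : Type*} [Ring R] {x y : R} (h : Commute x y)
    {a : R} {p q : ℕ} (hx : (innerDerivEnd x ^ p) a = 0) (hy : (innerDerivEnd y ^ q) a = 0) :
    (innerDerivEnd (x * y) ^ (q + p)) a = 0 := by
  rw [innerDerivEnd_mul]
  apply Module.End.add_pow_add_apply_eq_zero
  · exact ((LinearMap.commute_mulLeft_right x y).mul_right
      (commute_mulLeft_innerDerivEnd (Commute.refl x))).mul_left
      ((commute_mulRight_innerDerivEnd (Commute.refl y)).symm.mul_right
      (commute_innerDerivEnd h.symm))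
  · rw [(commute_mulLeft_innerDerivEnd h).mul_pow, Module.End.mul_apply, hy, map_zero]
  · rw [(commute_mulRight_innerDerivEnd h.symm).mul_pow, Module.End.mul_apply, hx, map_zero]

theorem exists_innerDerivEnd_list_prod_pow_apply_eq_zero {R : Type*} [Ring R] (a : R)
    (l : List R) (hcomm : ∀ x ∈ l, ∀ y ∈ l, Commute x y)
    (hnil : ∀ x ∈ l, ∃ n : ℕ, (innerDerivEnd x ^ n) a = 0) :
    ∃ n : ℕ, (innerDerivEnd l.prod ^ n) a = 0 := by
  induction l with
  | nil => exact ⟨1, by simp [innerDerivEnd_apply]⟩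
  | cons x l ih =>
    obtain ⟨p, hp⟩ := hnil x List.mem_cons_self
    obtain ⟨q, hq⟩ := ih
      (fun y hy z hz => hcomm y (List.mem_cons_of_mem x hy) z (List.mem_cons_of_mem x hz))
      (fun y hy => hnil y (List.mem_cons_of_mem x hy))
    have hx : Commute x l.prod := Commute.list_prod_right l x fun y hy =>
      hcomm x List.mem_cons_self y (List.mem_cons_of_mem x hy)
    rw [List.prod_cons]
    exact ⟨q + p, innerDerivEnd_mul_pow_apply_eq_zero hx hp hq⟩

/-- Let `R` be a unital associative ring and `f 0, …, f (m-1)` pairwise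
commuting elements such that each inner derivation `δ_{f i}` is locally nilpotent on `R`.
Then the inner derivation of the product `f 0 * f 1 * ⋯ * f (m-1)` is locally nilpotent. -/
theorem innerDeriv_prod_locally_nilpotent {R : Type*} [Ring R] (m : ℕ) (f : Fin m → R)
    (hcomm : ∀ i j, f i * f j = f j * f i)
    (hnil : ∀ i, ∀ a : R, ∃ n : ℕ, (fun b => f i * b - b * f i)^[n] a = 0) :
    ∀ a : R, ∃ n : ℕ,
      (fun b => (List.ofFn f).prod * b - b * (List.ofFn f).prod)^[n] a = 0 := by
  intro a
  simp only [← innerDerivEnd_pow_apply] at hnil ⊢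
  refine exists_innerDerivEnd_list_prod_pow_apply_eq_zero a _ ?_ ?_
  · simp only [List.forall_mem_ofFn_iff]
    exact hcomm
  · simp only [List.forall_mem_ofFn_iff]
    exact fun i => hnil i a
end

section
/- Let R be a unital associative ℂ-algebra, M a left R-module, and f ∈ R such that δ_f is locally nilpotent on R (δ_f(b) = f*b − b*f, and for every a ∈ R there is n with δ_f^n(a) = 0) and the action of f on M is bijective, with inverse map F : M → M. Fix x ∈ ℂ and define the x-twisted action of R on M by a ∗_x v := Σ_{j≥0} binom(x,j) · (δ_f^j(a)) • F^j(v), a finite sum, where binom(x,j) = x(x−1)⋯(x−j+1)/j!. Then for every a ∈ R: a • v = 0 for all v ∈ M if and only if a ∗_x v = 0 for all v ∈ M. In other words, the annihilator of M in R equals the annihilator of the x-twisted module in R. -/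
noncomputable section

/-- The inner derivation `δ_f b = f*b - b*f`. -/
def innerDeriv {R : Type*} [Ring R] (f : R) : R → R := fun b => f * b - b * f

/-- The generalised binomial coefficient `binom(x, j) = x(x-1)⋯(x-j+1)/j!` for `x : ℂ`. -/
def cchoose (x : ℂ) (j : ℕ) : ℂ :=
  (∏ i ∈ Finset.range j, (x - i)) / (j.factorial : ℂ)

/-- Mathieu's `x`-twisted action of `a : R` on `v : M`:
`a ∗ₓ v = ∑_{j ≥ 0} binom(x, j) • (δ_f^[j] a) • F^[j] v`, a finite sum when `δ_f` is
locally nilpotent, where `F` is the inverse of the (bijective) action of `f` on `M`. -/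
def twistedSMul {R M : Type*} [Ring R] [Algebra ℂ R] [AddCommGroup M] [Module R M]
    (f : R) (F : M → M) (x : ℂ) (a : R) (v : M) : M :=
  ∑ᶠ j : ℕ, (algebraMap ℂ R (cchoose x j) * (innerDeriv f)^[j] a) • F^[j] v

section TwistedAction

variable {R M : Type*} [Ring R]

lemma innerDeriv_zero (f : R) : innerDeriv f 0 = 0 := by
  simp [innerDeriv]

lemma innerDeriv_iterate_eq_zero_of_le {f a : R} {n j : ℕ}
    (h : (innerDeriv f)^[n] a = 0) (hj : n ≤ j) : (innerDeriv f)^[j] a = 0 := by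
  obtain ⟨k, rfl⟩ := Nat.exists_eq_add_of_le' hj
  rw [Function.iterate_add_apply, h, Function.iterate_fixed (innerDeriv_zero f)]

lemma cchoose_zero (x : ℂ) : cchoose x 0 = 1 := by
  simp [cchoose]

variable [AddCommGroup M] [Module R M]

lemma innerDeriv_iterate_smul_eq_zero {f a : R} (ha : ∀ v : M, a • v = 0) (j : ℕ) (v : M) :
    (innerDeriv f)^[j] a • v = 0 := by
  induction j generalizing v with
  | zero => exact ha v
  | succ j ih =>
    rw [Function.iterate_succ_apply', innerDeriv, sub_smul, mul_smul, mul_smul, ih, ih,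
      smul_zero, sub_zero]

lemma iterate_smul_comm {f : R} {F : M → M} (hFl : ∀ v : M, F (f • v) = v)
    (hFr : ∀ v : M, f • F v = v) (j : ℕ) (v : M) : F^[j] (f • v) = f • F^[j] v := by
  have h : Function.Commute F (f • ·) := fun w => (hFl w).trans (hFr w).symm
  exact h.iterate_left j v

variable [Algebra ℂ R]

lemma support_twistedSMul_finite {f a : R} (ha : ∃ n : ℕ, (innerDeriv f)^[n] a = 0)
    (F : M → M) (x : ℂ) (v : M) :
    (Function.support fun j : ℕ =>
      (algebraMap ℂ R (cchoose x j) * (innerDeriv f)^[j] a) • F^[j] v).Finite := by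
  obtain ⟨n, hn⟩ := ha
  refine (Set.finite_Iio n).subset fun j hj => ?_
  by_contra h
  exact hj (by simp [innerDeriv_iterate_eq_zero_of_le hn (not_lt.mp h)])

/-- The twisted action of `δ_f a` is the commutator of `f` with the twisted action of `a`. -/
lemma twistedSMul_innerDeriv {f a : R} {F : M → M}
    (ha : ∃ n : ℕ, (innerDeriv f)^[n] a = 0)
    (hFl : ∀ v : M, F (f • v) = v) (hFr : ∀ v : M, f • F v = v) (x : ℂ) (v : M) :
    twistedSMul f F x (innerDeriv f a) v =
      f • twistedSMul f F x a v - twistedSMul f F x a (f • v) := by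
  have hs := support_twistedSMul_finite ha F x
  unfold twistedSMul
  rw [smul_finsum' f (hs v), ← finsum_sub_distrib
    ((hs v).subset fun j hj h => hj (by simp only [h, smul_zero])) (hs (f • v))]
  refine finsum_congr fun j => ?_
  rw [iterate_smul_comm hFl hFr, ← Function.iterate_succ_apply, Function.iterate_succ_apply',
    smul_smul, smul_smul, ← sub_smul, innerDeriv, mul_sub, ← mul_assoc, ← mul_assoc, ← mul_assoc,
    Algebra.commutes (cchoose x j) f]

lemma twistedSMul_eq_smul {f a : R} (ha : ∀ v : M, innerDeriv f a • v = 0)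
    (F : M → M) (x : ℂ) (v : M) : twistedSMul f F x a v = a • v := by
  unfold twistedSMul
  rw [finsum_eq_single _ 0]
  · simp [cchoose_zero]
  · rintro (_ | j) hj
    · exact absurd rfl hj
    · rw [mul_smul, Function.iterate_succ_apply, innerDeriv_iterate_smul_eq_zero ha, smul_zero]

lemma smul_eq_zero_of_twistedSMul_eq_zero {f : R} {F : M → M}
    (hFl : ∀ v : M, F (f • v) = v) (hFr : ∀ v : M, f • F v = v) {x : ℂ} {n : ℕ} {a : R}
    (hn : (innerDeriv f)^[n] a = 0) (ha : ∀ v : M, twistedSMul f F x a v = 0) (v : M) :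
    a • v = 0 := by
  induction n generalizing a v with
  | zero => rw [show a = 0 from hn, zero_smul]
  | succ n ih =>
    have hδ : ∀ w : M, innerDeriv f a • w = 0 :=
      ih hn fun w => by
        rw [twistedSMul_innerDeriv ⟨_, hn⟩ hFl hFr, ha, ha, smul_zero, sub_zero]
    rw [← twistedSMul_eq_smul hδ F x, ha]

end TwistedAction

/-- Under local nilpotency of `δ_f` and bijectivity of the `f`-action
(with inverse `F`), an element `a : R` annihilates `M` iff it annihilates the
`x`-twisted module, i.e. `a ∗ₓ v = 0` for all `v`. -/
theorem annihilator_eq_annihilator_twisted {R M : Type*} [Ring R] [Algebra ℂ R]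
    [AddCommGroup M] [Module R M] (f : R) (F : M → M)
    (hnil : ∀ a : R, ∃ n : ℕ, (innerDeriv f)^[n] a = 0)
    (hFl : ∀ v : M, F (f • v) = v) (hFr : ∀ v : M, f • F v = v)
    (x : ℂ) (a : R) :
    (∀ v : M, a • v = 0) ↔ ∀ v : M, twistedSMul f F x a v = 0 := by
  refine ⟨fun ha v => ?_, fun ha v => ?_⟩
  · rw [twistedSMul_eq_smul (innerDeriv_iterate_smul_eq_zero ha 1), ha]
  · obtain ⟨n, hn⟩ := hnil a
    exact smul_eq_zero_of_twistedSMul_eq_zero hFl hFr hn ha v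
end
end

section
/- Let R be a unital associative ring, M a left R-module, L ⊆ M a simple R-submodule, and f ∈ R such that the action of f on M is injective and for every v ∈ M there exists r ∈ ℕ with f^r • v ∈ L. Then every nonzero R-submodule J of M contains L; in particular, the only R-submodule of M intersecting L trivially is the zero submodule. -/
/-- Let `R` be a ring, `M` a left `R`-module, `L ⊆ M` a simple
`R`-submodule, and `f : R` acting injectively on `M` such that every `v ∈ M` is carried
into `L` by some power of `f`.  Then every nonzero `R`-submodule `J` of `M` contains `L`;
in particular, the only submodule of `M` intersecting `L` trivially is zero. -/
theorem simple_submodule_le_of_saturating {R M : Type*} [Ring R] [AddCommGroup M]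
    [Module R M] (L : Submodule R M) (hL : IsSimpleModule R L)
    (f : R) (hinj : ∀ v : M, f • v = 0 → v = 0)
    (hsat : ∀ v : M, ∃ r : ℕ, f ^ r • v ∈ L) :
    ∀ J : Submodule R M, J ≠ ⊥ → L ≤ J := by
  intro J hJ
  have hpow (n : ℕ) (v : M) (h : f ^ n • v = 0) : v = 0 := by
    induction n with
    | zero => simpa using h
    | succ n ih => exact ih (hinj _ (by rwa [pow_succ', mul_smul] at h))
  obtain ⟨v, hvJ, hv⟩ := J.exists_mem_ne_zero_of_ne_bot hJ
  obtain ⟨r, hr⟩ := hsat v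
  have hmeet : L ⊓ J ≠ ⊥ := fun h =>
    hv (hpow r v ((Submodule.eq_bot_iff _).1 h _ ⟨hr, J.smul_mem _ hvJ⟩))
  exact ((isSimpleModule_iff_isAtom.1 hL).not_disjoint_iff_le).1
    fun h => hmeet h.eq_bot
end

section
/- Let R be a unital associative ring, M a left R-module, and f ∈ R such that δ_f is locally nilpotent on R (δ_f(b) = f*b − b*f, every element of R killed by some iterate of δ_f) and the action of f on M is bijective with inverse F : M → M. Then for every r ∈ R and w ∈ M one has F(r • w) = Σ_{j≥0} (−1)^j (δ_f^j(r)) • F^{j+1}(w), a finite sum. -/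
/-- Applying `f` to the truncated expansion of `F (r • w)` telescopes. -/
theorem smul_sum_range_neg_one_pow_smul_iterate {R M : Type*}
    [Ring R] [AddCommGroup M] [Module R M]
    (f : R) (F : M → M) (hFr : ∀ v : M, f • F v = v) (r : R) (w : M) (n : ℕ) :
    f • ∑ j ∈ Finset.range n,
        ((-1 : R) ^ j * (fun b => f * b - b * f)^[j] r) • F^[j + 1] w =
      r • w - ((-1 : R) ^ n * (fun b => f * b - b * f)^[n] r) • F^[n] w := by
  induction n with
  | zero => simp
  | succ n ih =>
    have hF : F^[n] w = f • F^[n + 1] w := by rw [Function.iterate_succ_apply', hFr]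
    have hcomm : f * (-1 : R) ^ n = (-1) ^ n * f :=
      ((Commute.neg_one_right f).pow_right n).eq
    rw [Finset.sum_range_succ, smul_add, ih, hF,
      Function.iterate_succ_apply' (fun b => f * b - b * f),
      smul_smul, smul_smul, ← mul_assoc, hcomm, sub_add, ← sub_smul]
    congr 2
    simp only [pow_succ]
    noncomm_ring

/-- Let `R` be a ring, `M` a left `R`-module, and `f : R` with locally
nilpotent inner derivation `δ_f b = f*b - b*f`, acting bijectively on `M` with inverse
`F`.  Then `F (r • w) = ∑_{j ≥ 0} (-1)^j (δ_f^[j] r) • F^[j+1] w`, a finite sum. -/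
theorem inverse_smul_comm {R M : Type*} [Ring R] [AddCommGroup M] [Module R M]
    (f : R) (F : M → M)
    (hnil : ∀ a : R, ∃ n : ℕ, (fun b => f * b - b * f)^[n] a = 0)
    (hFl : ∀ v : M, F (f • v) = v) (hFr : ∀ v : M, f • F v = v)
    (r : R) (w : M) :
    F (r • w) =
      ∑ᶠ j : ℕ, ((-1 : R) ^ j * (fun b => f * b - b * f)^[j] r) • F^[j + 1] w := by
  obtain ⟨n, hn⟩ := hnil r
  have hvanish : ∀ j, n ≤ j → (fun b => f * b - b * f)^[j] r = 0 := by
    intro j hj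
    obtain ⟨k, rfl⟩ := Nat.exists_eq_add_of_le' hj
    rw [Function.iterate_add_apply, hn]
    exact Function.iterate_fixed (by simp) k
  rw [finsum_eq_sum_of_support_subset (s := Finset.range n)]
  · have h := smul_sum_range_neg_one_pow_smul_iterate f F hFr r w n
    rw [hn, mul_zero, zero_smul, sub_zero] at h
    rw [← h, hFl]
  · intro j hj
    by_contra hjn
    apply hj
    simp only [Finset.coe_range, Set.mem_Iio, not_lt] at hjn
    simp only [hvanish j hjn, mul_zero, zero_smul]
end
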